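/- (New 4-variable non-Shannon-type inequality obtained by projecting the 7-variable cone H₇ ∩ C₇.) For any four jointly distributed discrete random variables X₁, X₂, X₃, X₄ with finite entropies: −34·H(1) − 2·H(2) − 11·H(3) − H(4) + 27·H(12) + 40·H(13) + 12·H(23) + 15·H(14) − 5·H(24) + 7·H(34) − 32·H(123) − 16·H(134) ≥ 0. -/

import Mathlib

open MeasureTheory

/-- The Shannon entropy of a random variable `X` taking values in a finite set,
computed from the distribution of `X` under the measure `μ`. -/
noncomputable def shannonEntropy {Ω : Type*} [MeasurableSpace Ω] (μ : Measure Ω)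
    {β : Type*} [Fintype β] (X : Ω → β) : ℝ :=
  ∑ b : β, Real.negMulLog ((μ (X ⁻¹' {b})).toReal)

section WeightedFamily

open Finset
open scoped Classical

variable {Ω T ι : Type*} [Fintype Ω]

/-- The mass that the weight `p` gives to the outcomes agreeing with `ω` on the variables `X k`,
`k ∈ S`. -/
noncomputable def jointMass (p : Ω → ℝ) (X : ι → Ω → T) (S : Finset ι) (ω : Ω) : ℝ :=
  ∑ ω', if ∀ k ∈ S, X k ω' = X k ω then p ω' else 0

/-- The joint entropy of the variables `X k`, `k ∈ S`, under the weight `p`, written as an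
expected surprisal. -/
noncomputable def jointEntropy (p : Ω → ℝ) (X : ι → Ω → T) (S : Finset ι) : ℝ :=
  -∑ ω, p ω * Real.log (jointMass p X S ω)

/-- The mass of the outcomes agreeing with `ω` on `S` at which `X i` takes the value `t`. -/
noncomputable def sliceMass (p : Ω → ℝ) (X : ι → Ω → T) (i : ι) (S : Finset ι) (ω : Ω) (t : T) :
    ℝ :=
  ∑ ω', if (∀ k ∈ S, X k ω' = X k ω) ∧ X i ω' = t then p ω' else 0

/-- The weight on `Ω × T` whose second coordinate is distributed as `X i` conditionally on the
variables in `V`, independently of everything else. -/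
noncomputable def copyWeight (p : Ω → ℝ) (X : ι → Ω → T) (i : ι) (V : Finset ι) (z : Ω × T) : ℝ :=
  p z.1 * (sliceMass p X i V z.1 z.2 / jointMass p X V z.1)

variable {p : Ω → ℝ} {X : ι → Ω → T}

theorem jointMass_nonneg (hp : ∀ ω, 0 ≤ p ω) (S : Finset ι) (ω : Ω) : 0 ≤ jointMass p X S ω :=
  sum_nonneg fun ω' _ => by split_ifs <;> simp [hp]

theorem sliceMass_nonneg (hp : ∀ ω, 0 ≤ p ω) (i : ι) (S : Finset ι) (ω : Ω) (t : T) :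
    0 ≤ sliceMass p X i S ω t :=
  sum_nonneg fun ω' _ => by split_ifs <;> simp [hp]

theorem le_jointMass (hp : ∀ ω, 0 ≤ p ω) (S : Finset ι) (ω : Ω) : p ω ≤ jointMass p X S ω := by
  have := single_le_sum (f := fun ω' => if ∀ k ∈ S, X k ω' = X k ω then p ω' else 0)
    (fun ω' _ => by split_ifs <;> simp [hp]) (mem_univ ω)
  simpa [jointMass] using this

theorem jointMass_congr {S : Finset ι} {ω ω' : Ω} (h : ∀ k ∈ S, X k ω' = X k ω) :
    jointMass p X S ω' = jointMass p X S ω := by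
  refine sum_congr rfl fun a _ => if_congr ?_ rfl rfl
  exact forall₂_congr fun k hk => by rw [h k hk]

theorem sliceMass_congr {i : ι} {S : Finset ι} {ω ω' : Ω} (h : ∀ k ∈ S, X k ω' = X k ω) (t : T) :
    sliceMass p X i S ω' t = sliceMass p X i S ω t := by
  refine sum_congr rfl fun a _ => if_congr (and_congr_left' ?_) rfl rfl
  exact forall₂_congr fun k hk => by rw [h k hk]

theorem copyWeight_nonneg (hp : ∀ ω, 0 ≤ p ω) (i : ι) (V : Finset ι) (z : Ω × T) :
    0 ≤ copyWeight p X i V z :=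
  mul_nonneg (hp _) (div_nonneg (sliceMass_nonneg hp _ _ _ _) (jointMass_nonneg hp _ _))

theorem mul_jointMass_div_self (hp : ∀ ω, 0 ≤ p ω) (S : Finset ι) (ω : Ω) :
    p ω * (jointMass p X S ω / jointMass p X S ω) = p ω := by
  rcases (hp ω).eq_or_lt with h | h
  · simp [← h]
  · rw [div_self (h.trans_le (le_jointMass hp S ω)).ne', mul_one]

theorem sum_sliceMass [Fintype T] (i : ι) (S : Finset ι) (ω : Ω) :
    ∑ t, sliceMass p X i S ω t = jointMass p X S ω := by
  simp only [sliceMass, jointMass]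
  rw [sum_comm]
  refine sum_congr rfl fun a _ => ?_
  by_cases h : ∀ k ∈ S, X k a = X k ω
  · simp only [ite_and, if_pos h]; simp
  · simp only [ite_and, if_neg h]; simp

/-- The first marginal of `copyWeight` is the original weight. -/
theorem sum_copyWeight_mul_fst [Fintype T] (hp : ∀ ω, 0 ≤ p ω) (i : ι) (V : Finset ι) (φ : Ω → ℝ) :
    ∑ z, copyWeight p X i V z * φ z.1 = ∑ ω, p ω * φ ω := by
  rw [Fintype.sum_prod_type]
  refine sum_congr rfl fun ω _ => ?_
  simp only [copyWeight]
  rw [← sum_mul, ← mul_sum, ← sum_div, sum_sliceMass, mul_jointMass_div_self hp]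

/-- Under `copyWeight`, the second coordinate is jointly distributed with the variables in `V` as
`X i` is. -/
theorem sum_copyWeight_mul_copy [Fintype T] (hp : ∀ ω, 0 ≤ p ω) (i : ι) (V : Finset ι)
    (φ : Ω → T → ℝ) (hφ : ∀ ω ω' t, (∀ k ∈ V, X k ω' = X k ω) → φ ω' t = φ ω t) :
    ∑ z, copyWeight p X i V z * φ z.1 z.2 = ∑ ω, p ω * φ ω (X i ω) := by
  rw [Fintype.sum_prod_type]
  have key : ∀ ω, ∑ t, copyWeight p X i V (ω, t) * φ ω t =
      ∑ ω', p ω' * φ ω' (X i ω') / jointMass p X V ω' *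
        (if ∀ k ∈ V, X k ω = X k ω' then p ω else 0) := by
    intro ω
    simp only [copyWeight, sliceMass, sum_div, mul_sum, sum_mul]
    rw [sum_comm]
    refine sum_congr rfl fun ω' _ => ?_
    by_cases h : ∀ k ∈ V, X k ω' = X k ω
    · have h' : ∀ k ∈ V, X k ω = X k ω' := fun k hk => (h k hk).symm
      rw [if_pos h', sum_eq_single (X i ω')]
      · rw [if_pos ⟨h, rfl⟩, hφ ω ω' _ h, jointMass_congr h]; ring
      · intro t _ ht
        rw [if_neg fun hh => ht hh.2.symm]; simp
      · simp
    · have h' : ¬ ∀ k ∈ V, X k ω = X k ω' := fun hh => h fun k hk => (hh k hk).symm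
      rw [if_neg h', mul_zero]
      exact sum_eq_zero fun t _ => by rw [if_neg fun hh => h hh.1]; simp
  simp only [key]
  rw [sum_comm]
  refine sum_congr rfl fun ω' _ => ?_
  rw [← mul_sum]
  change _ * jointMass p X V ω' = _
  conv_rhs => rw [← mul_jointMass_div_self (X := X) hp V ω']
  ring

variable [DecidableEq ι]

theorem sum_mul_jointMass_ratio_le (hp : ∀ ω, 0 ≤ p ω) (S R : Finset ι) :
    ∑ ω, p ω * (jointMass p X S ω * jointMass p X R ω /
      (jointMass p X (S ∪ R) ω * jointMass p X (S ∩ R) ω)) ≤ ∑ ω, p ω := by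
  have expand : ∀ ω, p ω * (jointMass p X S ω * jointMass p X R ω /
      (jointMass p X (S ∪ R) ω * jointMass p X (S ∩ R) ω)) =
      ∑ a, ∑ b, p a * p b * (if (∀ k ∈ S, X k a = X k ω) ∧ (∀ k ∈ R, X k b = X k ω) then
        p ω / (jointMass p X (S ∪ R) ω * jointMass p X (S ∩ R) ω) else 0) := by
    intro ω
    have : jointMass p X S ω * jointMass p X R ω =
        ∑ a, ∑ b, p a * p b * (if (∀ k ∈ S, X k a = X k ω) ∧ (∀ k ∈ R, X k b = X k ω) then
          1 else 0) := by
      rw [jointMass, jointMass, sum_mul_sum]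
      refine sum_congr rfl fun a _ => sum_congr rfl fun b _ => ?_
      rw [ite_and]
      split_ifs <;> simp
    rw [this, sum_div, mul_sum]
    refine sum_congr rfl fun a _ => ?_
    rw [sum_div, mul_sum]
    refine sum_congr rfl fun b _ => ?_
    split_ifs <;> ring
  simp only [expand]
  rw [sum_comm]
  have inner : ∀ a b, ∑ ω, (if (∀ k ∈ S, X k a = X k ω) ∧ (∀ k ∈ R, X k b = X k ω) then
      p ω / (jointMass p X (S ∪ R) ω * jointMass p X (S ∩ R) ω) else 0) ≤
      (if ∀ k ∈ S ∩ R, X k b = X k a then 1 else 0) / jointMass p X (S ∩ R) a := by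
    intro a b
    by_cases hex : ∃ c, (∀ k ∈ S, X k a = X k c) ∧ (∀ k ∈ R, X k b = X k c)
    · obtain ⟨c, hca, hcb⟩ := hex
      have hab : ∀ k ∈ S ∩ R, X k b = X k a := fun k hk => by
        rw [mem_inter] at hk
        rw [hca k hk.1, hcb k hk.2]
      have hac : ∀ k ∈ S ∩ R, X k a = X k c := fun k hk => hca k (mem_inter.1 hk).1
      have hiff : ∀ ω, ((∀ k ∈ S, X k a = X k ω) ∧ (∀ k ∈ R, X k b = X k ω)) ↔
          ∀ k ∈ S ∪ R, X k ω = X k c := by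
        intro ω
        constructor
        · rintro ⟨h₁, h₂⟩ k hk
          rcases mem_union.1 hk with hk | hk
          · rw [← h₁ k hk, hca k hk]
          · rw [← h₂ k hk, hcb k hk]
        · intro h
          exact ⟨fun k hk => by rw [h k (mem_union_left _ hk), hca k hk],
            fun k hk => by rw [h k (mem_union_right _ hk), hcb k hk]⟩
      have hsum : ∑ ω, (if (∀ k ∈ S, X k a = X k ω) ∧ (∀ k ∈ R, X k b = X k ω) then
          p ω / (jointMass p X (S ∪ R) ω * jointMass p X (S ∩ R) ω) else 0) =
          jointMass p X (S ∪ R) c / (jointMass p X (S ∪ R) c * jointMass p X (S ∩ R) c) := by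
        conv_rhs => rw [jointMass, sum_div]
        refine sum_congr rfl fun ω _ => ?_
        simp only [hiff]
        split_ifs with h
        · rw [jointMass_congr h, jointMass_congr (S := S ∩ R) (ω := c) fun k hk =>
            h k (mem_union_left _ (mem_inter.1 hk).1)]
          rfl
        · simp
      rw [hsum, if_pos hab, jointMass_congr hac, ← div_div]
      exact div_le_div_of_nonneg_right (div_self_le_one _) (jointMass_nonneg hp _ _)
    · rw [sum_eq_zero fun ω _ => if_neg fun h => hex ⟨ω, h⟩]
      exact div_nonneg (by split_ifs <;> simp) (jointMass_nonneg hp _ _)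
  refine sum_le_sum fun a _ => ?_
  rw [sum_comm]
  calc ∑ b, ∑ ω, p a * p b * (if (∀ k ∈ S, X k a = X k ω) ∧ (∀ k ∈ R, X k b = X k ω) then
        p ω / (jointMass p X (S ∪ R) ω * jointMass p X (S ∩ R) ω) else 0)
      ≤ ∑ b, p a * p b *
        ((if ∀ k ∈ S ∩ R, X k b = X k a then 1 else 0) / jointMass p X (S ∩ R) a) := by
        refine sum_le_sum fun b _ => ?_
        rw [← mul_sum]
        exact mul_le_mul_of_nonneg_left (inner a b) (mul_nonneg (hp a) (hp b))
    _ = p a * (jointMass p X (S ∩ R) a / jointMass p X (S ∩ R) a) := by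
        conv_rhs => rw [jointMass, sum_div, mul_sum]
        refine sum_congr rfl fun b _ => ?_
        split_ifs
        · change _ = p a * (p b / jointMass p X (S ∩ R) a)
          ring
        · simp
    _ = p a := mul_jointMass_div_self hp _ _

theorem jointEntropy_submodular (hp : ∀ ω, 0 ≤ p ω) (S R : Finset ι) :
    jointEntropy p X (S ∪ R) + jointEntropy p X (S ∩ R) ≤
      jointEntropy p X S + jointEntropy p X R := by
  have key : ∀ ω, p ω * Real.log (jointMass p X S ω) + p ω * Real.log (jointMass p X R ω) -
      (p ω * Real.log (jointMass p X (S ∪ R) ω) + p ω * Real.log (jointMass p X (S ∩ R) ω)) ≤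
      p ω * (jointMass p X S ω * jointMass p X R ω /
        (jointMass p X (S ∪ R) ω * jointMass p X (S ∩ R) ω)) - p ω := by
    intro ω
    rcases (hp ω).eq_or_lt with h | h
    · simp [← h]
    · have pos : ∀ Q : Finset ι, 0 < jointMass p X Q ω := fun Q => h.trans_le (le_jointMass hp Q ω)
      have hlog := Real.log_le_sub_one_of_pos
        (div_pos (mul_pos (pos S) (pos R)) (mul_pos (pos (S ∪ R)) (pos (S ∩ R))))
      rw [Real.log_div (mul_pos (pos _) (pos _)).ne' (mul_pos (pos _) (pos _)).ne',
        Real.log_mul (pos _).ne' (pos _).ne', Real.log_mul (pos _).ne' (pos _).ne'] at hlog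
      have := mul_le_mul_of_nonneg_left hlog h.le
      linarith
  have hsum := sum_le_sum fun ω (_ : ω ∈ univ) => key ω
  simp only [sum_sub_distrib, sum_add_distrib] at hsum
  have := sum_mul_jointMass_ratio_le (X := X) hp S R
  simp only [jointEntropy]
  linarith

/-- The family `X` on `Ω × T` with its `j`-th variable replaced by the second coordinate. -/
noncomputable def copyVar (X : ι → Ω → T) (j : ι) (k : ι) (z : Ω × T) : T :=
  if k = j then z.2 else X k z.1

theorem agree_copyVar_insert {Ω T ι : Type*} [DecidableEq ι] {X : ι → Ω → T} {j : ι}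
    {S : Finset ι} (hj : j ∉ S) (z w : Ω × T) :
    (∀ k ∈ insert j S, copyVar X j k w = copyVar X j k z) ↔
      (∀ k ∈ S, X k w.1 = X k z.1) ∧ w.2 = z.2 := by
  rw [forall_mem_insert, and_comm]
  refine and_congr (forall₂_congr fun k hk => ?_) (by simp [copyVar])
  have : k ≠ j := fun e => hj (e ▸ hk)
  simp [copyVar, this]

variable [Fintype T]

theorem jointMass_copy_of_notMem (hp : ∀ ω, 0 ≤ p ω) (i : ι) {j : ι} (V : Finset ι)
    {S : Finset ι} (hj : j ∉ S) (z : Ω × T) :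
    jointMass (copyWeight p X i V) (copyVar X j) S z = jointMass p X S z.1 := by
  have h := sum_copyWeight_mul_fst (X := X) hp i V
    fun ω => if ∀ k ∈ S, X k ω = X k z.1 then 1 else 0
  simp only [mul_ite, mul_one, mul_zero] at h
  rw [jointMass, jointMass, ← h]
  refine sum_congr rfl fun w _ => if_congr (forall₂_congr fun k hk => ?_) rfl rfl
  have : k ≠ j := fun e => hj (e ▸ hk)
  simp [copyVar, this]

theorem jointMass_copy_insert (hp : ∀ ω, 0 ≤ p ω) (i : ι) {j : ι} {V S : Finset ι} (hj : j ∉ V)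
    (hS : S ⊆ V) (z : Ω × T) :
    jointMass (copyWeight p X i V) (copyVar X j) (insert j S) z = sliceMass p X i S z.1 z.2 := by
  have h := sum_copyWeight_mul_copy (X := X) hp i V
    (fun ω t => if (∀ k ∈ S, X k ω = X k z.1) ∧ t = z.2 then 1 else 0) (by
      intro ω ω' t h
      refine if_congr (and_congr_left' (forall₂_congr fun k hk => ?_)) rfl rfl
      rw [h k (hS hk)])
  simp only [mul_ite, mul_one, mul_zero] at h
  rw [jointMass, sliceMass, ← h]
  exact sum_congr rfl fun w _ => if_congr (agree_copyVar_insert (fun e => hj (hS e)) z w) rfl rfl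

theorem jointMass_copy_insert_of_subset {i j : ι} {V W : Finset ι}
    (hj : j ∉ W) (hV : V ⊆ W) (z : Ω × T) :
    jointMass (copyWeight p X i V) (copyVar X j) (insert j W) z =
      jointMass p X W z.1 * (sliceMass p X i V z.1 z.2 / jointMass p X V z.1) := by
  rw [jointMass, Fintype.sum_prod_type, jointMass, sum_mul]
  refine sum_congr rfl fun ω _ => ?_
  simp only [agree_copyVar_insert hj]
  by_cases h : ∀ k ∈ W, X k ω = X k z.1
  · have hh : ∀ k ∈ V, X k ω = X k z.1 := fun k hk => h k (hV hk)
    rw [if_pos h, sum_eq_single z.2]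
    · rw [if_pos ⟨h, rfl⟩, copyWeight, sliceMass_congr hh, jointMass_congr hh]
    · intro t _ ht
      rw [if_neg fun e => ht e.2]
    · simp
  · rw [if_neg h, zero_mul]
    exact sum_eq_zero fun t _ => if_neg fun e => h e.1

/-- Adjoining a copy does not change the entropies of the other variables. -/
theorem jointEntropy_copy_of_notMem (hp : ∀ ω, 0 ≤ p ω) (i : ι) {j : ι} (V : Finset ι)
    {S : Finset ι} (hj : j ∉ S) :
    jointEntropy (copyWeight p X i V) (copyVar X j) S = jointEntropy p X S := by
  simp only [jointEntropy, jointMass_copy_of_notMem hp i V hj]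
  rw [sum_copyWeight_mul_fst hp i V fun ω => Real.log (jointMass p X S ω)]

/-- The copy has the same joint entropies with variables in `V` as the original variable. -/
theorem jointEntropy_copy_insert (hp : ∀ ω, 0 ≤ p ω) (i : ι) {j : ι} {V S : Finset ι} (hj : j ∉ V)
    (hS : S ⊆ V) :
    jointEntropy (copyWeight p X i V) (copyVar X j) (insert j S) =
      jointEntropy p X (insert i S) := by
  simp only [jointEntropy, jointMass_copy_insert hp i hj hS]
  rw [sum_copyWeight_mul_copy hp i V fun ω t => Real.log (sliceMass p X i S ω t)]
  · congr 1
    refine sum_congr rfl fun ω _ => ?_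
    congr 2
    refine sum_congr rfl fun a _ => if_congr ?_ rfl rfl
    rw [forall_mem_insert, and_comm]
  · intro ω ω' t h
    rw [sliceMass_congr fun k hk => h k (hS hk)]

/-- The copy is independent of all other variables conditionally on the variables in `V`. -/
theorem jointEntropy_copy_condIndep (hp : ∀ ω, 0 ≤ p ω) (i : ι) {j : ι} {V W : Finset ι}
    (hj : j ∉ W) (hV : V ⊆ W) :
    jointEntropy (copyWeight p X i V) (copyVar X j) (insert j W) +
        jointEntropy (copyWeight p X i V) (copyVar X j) V =
      jointEntropy (copyWeight p X i V) (copyVar X j) (insert j V) +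
        jointEntropy (copyWeight p X i V) (copyVar X j) W := by
  have hjV : j ∉ V := fun e => hj (hV e)
  simp only [jointEntropy, jointMass_copy_insert_of_subset hj hV,
    jointMass_copy_insert hp i hjV Subset.rfl, jointMass_copy_of_notMem hp i V hj,
    jointMass_copy_of_notMem hp i V hjV]
  rw [← neg_add, ← neg_add, ← sum_add_distrib, ← sum_add_distrib]
  congr 1
  refine sum_congr rfl fun z _ => ?_
  rw [← mul_add, ← mul_add]
  rcases eq_or_ne (copyWeight p X i V z) 0 with h0 | h0
  · simp [h0]
  · have hz : p z.1 ≠ 0 := left_ne_zero_of_mul h0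
    have hs : sliceMass p X i V z.1 z.2 / jointMass p X V z.1 ≠ 0 := right_ne_zero_of_mul h0
    have hpos : 0 < p z.1 := (hp _).lt_of_ne' hz
    have hW := (hpos.trans_le (le_jointMass (X := X) hp W z.1)).ne'
    have hV' := (hpos.trans_le (le_jointMass (X := X) hp V z.1)).ne'
    rw [Real.log_mul hW hs, Real.log_div (div_ne_zero_iff.1 hs).1 hV']
    ring

end WeightedFamily

section FromMeasure

open Finset
open scoped Classical

/-- The entropy of a function of a finite-valued variable, as an expected surprisal. -/
theorem shannonEntropy_comp {Ω : Type*} [MeasurableSpace Ω] (μ : Measure Ω) [IsFiniteMeasure μ]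
    {γ β : Type*} [Fintype γ] [Fintype β] (Z : Ω → γ) (hZ : ∀ c, MeasurableSet (Z ⁻¹' {c}))
    (f : γ → β) :
    shannonEntropy μ (fun ω => f (Z ω)) =
      -∑ c, μ.real (Z ⁻¹' {c}) *
        Real.log (∑ c', if f c' = f c then μ.real (Z ⁻¹' {c'}) else 0) := by
  have hpre : ∀ b, (μ ((fun ω => f (Z ω)) ⁻¹' {b})).toReal =
      ∑ c, if f c = b then μ.real (Z ⁻¹' {c}) else 0 := by
    intro b
    have hU : (fun ω => f (Z ω)) ⁻¹' {b} = ⋃ c ∈ univ.filter fun c => f c = b, Z ⁻¹' {c} := by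
      ext ω; simp
    change μ.real _ = _
    rw [hU, measureReal_biUnion_finset _ fun c _ => hZ c, sum_filter]
    intro c _ d _ hcd
    exact Disjoint.preimage Z (Set.disjoint_singleton.2 hcd)
  simp only [shannonEntropy, hpre, Real.negMulLog, neg_mul, sum_neg_distrib, sum_mul]
  rw [sum_comm]
  congr 1
  refine sum_congr rfl fun c _ => ?_
  rw [sum_eq_single (f c)]
  · simp
  · intro b _ hb
    rw [if_neg hb.symm, zero_mul]
  · simp

theorem jointEntropy_eq_shannonEntropy {Ω : Type*} [MeasurableSpace Ω] (μ : Measure Ω)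
    [IsFiniteMeasure μ] {γ β T ι : Type*} [Fintype γ] [Fintype β] (Z : Ω → γ)
    (hZ : ∀ c, MeasurableSet (Z ⁻¹' {c})) (Y : ι → γ → T) (f : γ → β) (S : Finset ι)
    (hS : ∀ c d, (∀ k ∈ S, Y k c = Y k d) ↔ f c = f d) :
    jointEntropy (fun c => μ.real (Z ⁻¹' {c})) Y S = shannonEntropy μ (fun ω => f (Z ω)) := by
  rw [shannonEntropy_comp μ Z hZ f]
  simp only [jointEntropy, jointMass, hS]

end FromMeasure

section Polymatroid

/-- The linear inequality satisfied by submodular functions on seven variables in which `4` is a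
copy of `2` over `{0, 1}`, `5` is a copy of `2` over `{0, 3, 4}` and `6` is a copy of `1` over
`{0, 2, 4, 5}`. -/
theorem submodular_copy_inequality (h : Finset (Fin 7) → ℝ)
    (hsub : ∀ S R, h (S ∪ R) + h (S ∩ R) ≤ h S + h R)
    (hcopy4 : ∀ S ⊆ {0, 1}, h (insert 4 S) = h (insert 2 S))
    (hcopy5 : ∀ S ⊆ {0, 3, 4}, h (insert 5 S) = h (insert 2 S))
    (hcopy6 : ∀ S ⊆ {0, 2, 4, 5}, h (insert 6 S) = h (insert 1 S))
    (indep4 : h {0, 1, 4} + h {0, 1, 2, 3} ≤ h {0, 1, 2, 3, 4} + h {0, 1})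
    (indep5 : h {0, 3, 4, 5} + h {0, 1, 2, 3, 4} ≤ h {0, 1, 2, 3, 4, 5} + h {0, 3, 4})
    (indep6 : h {0, 2, 4, 5, 6} + h {0, 1, 2, 3, 4, 5} ≤
      h {0, 1, 2, 3, 4, 5, 6} + h {0, 2, 4, 5}) :
    -34 * h {0} - 2 * h {1} - 11 * h {2} - h {3} + 27 * h {0, 1} + 40 * h {0, 2} + 12 * h {1, 2}
      + 15 * h {0, 3} - 5 * h {1, 3} + 7 * h {2, 3} - 32 * h {0, 1, 2} - 16 * h {0, 2, 3} ≥ 0 := by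
  have sub : ∀ (S R U I : Finset (Fin 7)) (_ : S ∪ R = U ∧ S ∩ R = I := by decide),
      h U + h I ≤ h S + h R := by
    rintro S R _ _ ⟨rfl, rfl⟩
    exact hsub S R
  have copy4 : ∀ (S A B : Finset (Fin 7))
      (_ : S ⊆ {0, 1} ∧ insert 4 S = A ∧ insert 2 S = B := by decide), h A = h B := by
    rintro S _ _ ⟨hS, rfl, rfl⟩
    exact hcopy4 S hS
  have copy5 : ∀ (S A B : Finset (Fin 7))
      (_ : S ⊆ {0, 3, 4} ∧ insert 5 S = A ∧ insert 2 S = B := by decide), h A = h B := by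
    rintro S _ _ ⟨hS, rfl, rfl⟩
    exact hcopy5 S hS
  have copy6 : ∀ (S A B : Finset (Fin 7))
      (_ : S ⊆ {0, 2, 4, 5} ∧ insert 6 S = A ∧ insert 1 S = B := by decide), h A = h B := by
    rintro S _ _ ⟨hS, rfl, rfl⟩
    exact hcopy6 S hS
  linear_combination
    25 * indep4
    + 12 * indep5
    + 8 * indep6
    + 1 * sub {0, 2, 4, 6} {1, 2, 4, 6} {0, 1, 2, 4, 6} {2, 4, 6}
    + 1 * sub {0, 2, 4} {1, 2, 4} {0, 1, 2, 4} {2, 4}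
    + 1 * sub {0, 1, 4, 5, 6} {1, 2, 4, 5, 6} {0, 1, 2, 4, 5, 6} {1, 4, 5, 6}
    + 1 * sub {0, 3, 4, 6} {2, 3, 4, 6} {0, 2, 3, 4, 6} {3, 4, 6}
    + 2 * sub {0, 3, 6} {2, 3, 6} {0, 2, 3, 6} {3, 6}
    + 1 * sub {0, 2, 5} {2, 3, 5} {0, 2, 3, 5} {2, 5}
    + 2 * sub {0, 1, 2, 3} {1, 2, 3, 4} {0, 1, 2, 3, 4} {1, 2, 3}
    + 2 * sub {0, 1, 2, 3, 4, 6} {1, 2, 3, 4, 5, 6} {0, 1, 2, 3, 4, 5, 6} {1, 2, 3, 4, 6}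
    + 3 * sub {0, 1, 2, 3, 4, 5} {1, 2, 3, 4, 5, 6} {0, 1, 2, 3, 4, 5, 6} {1, 2, 3, 4, 5}
    + 1 * sub {1, 4, 5, 6} {3, 4, 5, 6} {1, 3, 4, 5, 6} {4, 5, 6}
    + 2 * sub {1, 6} {3, 6} {1, 3, 6} {6}
    + 1 * sub {1, 5} {3, 5} {1, 3, 5} {5}
    + 1 * sub {1, 4} {3, 4} {1, 3, 4} {4}
    + 13 * sub {0, 1, 2, 3} {0, 2, 3, 4} {0, 1, 2, 3, 4} {0, 2, 3}
    + 2 * sub {0, 1, 2, 4, 6} {0, 2, 4, 5, 6} {0, 1, 2, 4, 5, 6} {0, 2, 4, 6}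
    + 1 * sub {1, 2, 4, 6} {2, 4, 5, 6} {1, 2, 4, 5, 6} {2, 4, 6}
    + 2 * sub {0, 1, 4} {0, 4, 5} {0, 1, 4, 5} {0, 4}
    + 1 * sub {0, 1, 2, 3} {0, 2, 3, 5} {0, 1, 2, 3, 5} {0, 2, 3}
    + 1 * sub {1, 2} {2, 5} {1, 2, 5} {2}
    + 1 * sub {0, 1, 4, 5} {0, 4, 5, 6} {0, 1, 4, 5, 6} {0, 4, 5}
    + 3 * sub {0, 1, 2, 3, 4} {0, 2, 3, 4, 6} {0, 1, 2, 3, 4, 6} {0, 2, 3, 4}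
    + 2 * sub {1, 4} {4, 6} {1, 4, 6} {4}
    + 2 * sub {1, 2} {2, 6} {1, 2, 6} {2}
    + 1 * sub {2, 5, 6} {4, 5, 6} {2, 4, 5, 6} {5, 6}
    + 2 * sub {1, 2, 6} {1, 4, 6} {1, 2, 4, 6} {1, 6}
    + 8 * sub {0, 2, 5} {0, 4, 5} {0, 2, 4, 5} {0, 5}
    + 2 * sub {1, 2, 3} {1, 3, 4} {1, 2, 3, 4} {1, 3}
    + 10 * sub {0, 2} {0, 4} {0, 2, 4} {0}
    + 1 * sub {1, 2, 3, 4, 6} {1, 3, 4, 5, 6} {1, 2, 3, 4, 5, 6} {1, 3, 4, 6}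
    + 1 * sub {1, 2, 3, 4} {1, 3, 4, 5} {1, 2, 3, 4, 5} {1, 3, 4}
    + 1 * sub {2, 3} {3, 5} {2, 3, 5} {3}
    + 9 * sub {0, 2} {0, 5} {0, 2, 5} {0}
    + 3 * sub {1, 2, 3, 4} {1, 3, 4, 6} {1, 2, 3, 4, 6} {1, 3, 4}
    + 1 * sub {2, 3, 6} {2, 4, 6} {2, 3, 4, 6} {2, 6}
    + 1 * sub {0, 3, 6} {0, 4, 6} {0, 3, 4, 6} {0, 6}
    + 1 * sub {3, 5} {4, 5} {3, 4, 5} {5}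
    + 10 * sub {0, 1, 2, 3} {0, 1, 2, 4} {0, 1, 2, 3, 4} {0, 1, 2}
    + 12 * sub {0, 3} {0, 4} {0, 3, 4} {0}
    + 1 * sub {0, 1, 2, 3, 4, 6} {0, 1, 2, 4, 5, 6} {0, 1, 2, 3, 4, 5, 6} {0, 1, 2, 4, 6}
    + 8 * sub {0, 1, 2, 3, 4} {0, 1, 2, 4, 5} {0, 1, 2, 3, 4, 5} {0, 1, 2, 4}
    + 2 * sub {0, 1, 2, 3, 4, 5} {0, 1, 2, 4, 5, 6} {0, 1, 2, 3, 4, 5, 6} {0, 1, 2, 4, 5}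
    + 3 * sub {2, 3} {2, 6} {2, 3, 6} {2}
    + 3 * sub {0, 3} {0, 6} {0, 3, 6} {0}
    + 1 * sub {0, 1, 2, 3, 4} {0, 1, 2, 3, 5} {0, 1, 2, 3, 4, 5} {0, 1, 2, 3}
    + 1 * sub {1, 3, 4} {1, 3, 5} {1, 3, 4, 5} {1, 3}
    + 2 * sub {0, 2, 3, 4} {0, 2, 3, 6} {0, 2, 3, 4, 6} {0, 2, 3}
    + 2 * sub {1, 3, 4} {1, 3, 6} {1, 3, 4, 6} {1, 3}
    + 4 * sub {1, 2, 3, 4, 5} {1, 2, 3, 4, 6} {1, 2, 3, 4, 5, 6} {1, 2, 3, 4}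
    + 1 * sub {3, 4, 5} {3, 4, 6} {3, 4, 5, 6} {3, 4}
    + -6 * copy6 {0, 2, 4, 5} {0, 2, 4, 5, 6} {0, 1, 2, 4, 5}
    + -1 * copy6 {0, 2, 4} {0, 2, 4, 6} {0, 1, 2, 4}
    + 1 * copy6 {0, 4, 5} {0, 4, 5, 6} {0, 1, 4, 5}
    + 1 * copy6 {0, 4} {0, 4, 6} {0, 1, 4}
    + 2 * copy6 {0} {0, 6} {0, 1}
    + -1 * copy6 {2, 4} {2, 4, 6} {1, 2, 4}
    + 1 * copy6 {2, 5} {2, 5, 6} {1, 2, 5}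
    + 4 * copy6 {2} {2, 6} {1, 2}
    + 2 * copy6 {4} {4, 6} {1, 4}
    + -1 * copy6 {5} {5, 6} {1, 5}
    + -2 * copy6 {} {6} {1}
    + -12 * copy5 {0, 3, 4} {0, 3, 4, 5} {0, 2, 3, 4}
    + 9 * copy5 {0, 4} {0, 4, 5} {0, 2, 4}
    + 1 * copy5 {0} {0, 5} {0, 2}
    + 3 * copy5 {3} {3, 5} {2, 3}
    + 1 * copy5 {4} {4, 5} {2, 4}
    + -2 * copy5 {} {5} {2}
    + -22 * copy4 {0, 1} {0, 1, 4} {0, 1, 2}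
    + 20 * copy4 {0} {0, 4} {0, 2}
    + 5 * copy4 {1} {1, 4} {1, 2}
    + -3 * copy4 {} {4} {2}

end Polymatroid

/-- Any four of the variables of a finite weighted family, `X 0`, …, `X 3`, satisfy the
inequality. -/
theorem jointEntropy_four_variable_inequality {Ω T : Type*} [Fintype Ω] [Fintype T] {p : Ω → ℝ}
    (hp : ∀ ω, 0 ≤ p ω) (X : Fin 7 → Ω → T) :
    -34 * jointEntropy p X {0} - 2 * jointEntropy p X {1} - 11 * jointEntropy p X {2}
      - jointEntropy p X {3} + 27 * jointEntropy p X {0, 1} + 40 * jointEntropy p X {0, 2}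
      + 12 * jointEntropy p X {1, 2} + 15 * jointEntropy p X {0, 3} - 5 * jointEntropy p X {1, 3}
      + 7 * jointEntropy p X {2, 3} - 32 * jointEntropy p X {0, 1, 2}
      - 16 * jointEntropy p X {0, 2, 3} ≥ 0 := by
  let X₁ : Fin 7 → Ω × T → T := copyVar X 4
  let p₁ : Ω × T → ℝ := copyWeight p X 2 {0, 1}
  let X₂ : Fin 7 → (Ω × T) × T → T := copyVar X₁ 5
  let p₂ : (Ω × T) × T → ℝ := copyWeight p₁ X₁ 2 {0, 3, 4}
  let X₃ : Fin 7 → ((Ω × T) × T) × T → T := copyVar X₂ 6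
  let p₃ : ((Ω × T) × T) × T → ℝ := copyWeight p₂ X₂ 1 {0, 2, 4, 5}
  have hp₁ : ∀ z, 0 ≤ p₁ z := copyWeight_nonneg hp _ _
  have hp₂ : ∀ z, 0 ≤ p₂ z := copyWeight_nonneg hp₁ _ _
  have hp₃ : ∀ z, 0 ≤ p₃ z := copyWeight_nonneg hp₂ _ _
  have e₁ : ∀ S : Finset (Fin 7), 4 ∉ S → jointEntropy p₁ X₁ S = jointEntropy p X S :=
    fun S hS => jointEntropy_copy_of_notMem hp _ _ hS
  have e₂ : ∀ S : Finset (Fin 7), 5 ∉ S → jointEntropy p₂ X₂ S = jointEntropy p₁ X₁ S :=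
    fun S hS => jointEntropy_copy_of_notMem hp₁ _ _ hS
  have e₃ : ∀ S : Finset (Fin 7), 6 ∉ S → jointEntropy p₃ X₃ S = jointEntropy p₂ X₂ S :=
    fun S hS => jointEntropy_copy_of_notMem hp₂ _ _ hS
  have main := submodular_copy_inequality (jointEntropy p₃ X₃)
    (jointEntropy_submodular hp₃)
    (fun S hS => by
      have h4 : 4 ∉ S := fun h => absurd (hS h) (by decide)
      have h5 : 5 ∉ S := fun h => absurd (hS h) (by decide)
      have h6 : 6 ∉ S := fun h => absurd (hS h) (by decide)
      rw [e₃ _ (by simp [h6]), e₃ _ (by simp [h6]), e₂ _ (by simp [h5]), e₂ _ (by simp [h5]),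
        e₁ (insert 2 S) (by simp [h4])]
      exact jointEntropy_copy_insert hp 2 (j := 4) (V := {0, 1}) (by decide) hS)
    (fun S hS => by
      have h5 : 5 ∉ S := fun h => absurd (hS h) (by decide)
      have h6 : 6 ∉ S := fun h => absurd (hS h) (by decide)
      rw [e₃ _ (by simp [h6]), e₃ _ (by simp [h6]), e₂ (insert 2 S) (by simp [h5])]
      exact jointEntropy_copy_insert hp₁ 2 (j := 5) (V := {0, 3, 4}) (by decide) hS)
    (fun S hS => by
      have h6 : 6 ∉ S := fun h => absurd (hS h) (by decide)
      rw [e₃ (insert 1 S) (by simp [h6])]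
      exact jointEntropy_copy_insert hp₂ 1 (j := 6) (V := {0, 2, 4, 5}) (by decide) hS)
    (by
      have := jointEntropy_copy_condIndep (X := X) hp 2 (j := 4) (V := {0, 1})
        (W := {0, 1, 2, 3}) (by decide) (by decide)
      rw [e₃ _ (by decide), e₃ _ (by decide), e₃ _ (by decide), e₃ _ (by decide),
        e₂ _ (by decide), e₂ _ (by decide), e₂ _ (by decide), e₂ _ (by decide)]
      rw [show insert 4 {0, 1, 2, 3} = ({0, 1, 2, 3, 4} : Finset (Fin 7)) by decide,
        show insert 4 {0, 1} = ({0, 1, 4} : Finset (Fin 7)) by decide] at this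
      exact this.ge)
    (by
      have := jointEntropy_copy_condIndep (X := X₁) hp₁ 2 (j := 5) (V := {0, 3, 4})
        (W := {0, 1, 2, 3, 4}) (by decide) (by decide)
      rw [e₃ _ (by decide), e₃ _ (by decide), e₃ _ (by decide), e₃ _ (by decide)]
      rw [show insert 5 {0, 1, 2, 3, 4} = ({0, 1, 2, 3, 4, 5} : Finset (Fin 7)) by decide,
        show insert 5 {0, 3, 4} = ({0, 3, 4, 5} : Finset (Fin 7)) by decide] at this
      exact this.ge)
    (by
      have := jointEntropy_copy_condIndep (X := X₂) hp₂ 1 (j := 6) (V := {0, 2, 4, 5})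
        (W := {0, 1, 2, 3, 4, 5}) (by decide) (by decide)
      rw [show insert 6 {0, 1, 2, 3, 4, 5} = ({0, 1, 2, 3, 4, 5, 6} : Finset (Fin 7)) by decide,
        show insert 6 {0, 2, 4, 5} = ({0, 2, 4, 5, 6} : Finset (Fin 7)) by decide] at this
      exact this.ge)
  have e : ∀ S : Finset (Fin 7), 4 ∉ S ∧ 5 ∉ S ∧ 6 ∉ S →
      jointEntropy p₃ X₃ S = jointEntropy p X S :=
    fun S hS => (e₃ S hS.2.2).trans ((e₂ S hS.2.1).trans (e₁ S hS.1))
  rw [e {0} (by decide), e {1} (by decide), e {2} (by decide), e {3} (by decide),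
    e {0, 1} (by decide), e {0, 2} (by decide), e {1, 2} (by decide), e {0, 3} (by decide),
    e {1, 3} (by decide), e {2, 3} (by decide), e {0, 1, 2} (by decide),
    e {0, 2, 3} (by decide)] at main
  exact main

theorem new_inequality_from_H7_second
    {Ω : Type*} [MeasurableSpace Ω] (μ : Measure Ω) [IsProbabilityMeasure μ]
    {α₁ α₂ α₃ α₄ : Type*} [Fintype α₁] [Fintype α₂] [Fintype α₃] [Fintype α₄]
    [MeasurableSpace α₁] [MeasurableSpace α₂] [MeasurableSpace α₃] [MeasurableSpace α₄]
    [DiscreteMeasurableSpace α₁] [DiscreteMeasurableSpace α₂]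
    [DiscreteMeasurableSpace α₃] [DiscreteMeasurableSpace α₄]
    (X₁ : Ω → α₁) (X₂ : Ω → α₂) (X₃ : Ω → α₃) (X₄ : Ω → α₄)
    (hX₁ : Measurable X₁) (hX₂ : Measurable X₂) (hX₃ : Measurable X₃) (hX₄ : Measurable X₄) :
    -34 * shannonEntropy μ X₁
      - 2 * shannonEntropy μ X₂
      - 11 * shannonEntropy μ X₃
      - shannonEntropy μ X₄
      + 27 * shannonEntropy μ (fun ω => (X₁ ω, X₂ ω))
      + 40 * shannonEntropy μ (fun ω => (X₁ ω, X₃ ω))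
      + 12 * shannonEntropy μ (fun ω => (X₂ ω, X₃ ω))
      + 15 * shannonEntropy μ (fun ω => (X₁ ω, X₄ ω))
      - 5 * shannonEntropy μ (fun ω => (X₂ ω, X₄ ω))
      + 7 * shannonEntropy μ (fun ω => (X₃ ω, X₄ ω))
      - 32 * shannonEntropy μ (fun ω => (X₁ ω, X₂ ω, X₃ ω))
      - 16 * shannonEntropy μ (fun ω => (X₁ ω, X₃ ω, X₄ ω)) ≥ 0 := by
  let Z : Ω → α₁ × α₂ × α₃ × α₄ := fun ω => (X₁ ω, X₂ ω, X₃ ω, X₄ ω)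
  have hZ : ∀ c, MeasurableSet (Z ⁻¹' {c}) := fun c =>
    (hX₁.prodMk (hX₂.prodMk (hX₃.prodMk hX₄))) (measurableSet_singleton c)
  let a : α₁ × α₂ × α₃ × α₄ → α₁ ⊕ α₂ ⊕ α₃ ⊕ α₄ := fun c => Sum.inl c.1
  let Y : Fin 7 → α₁ × α₂ × α₃ × α₄ → α₁ ⊕ α₂ ⊕ α₃ ⊕ α₄ :=
    ![a, fun c => Sum.inr (Sum.inl c.2.1), fun c => Sum.inr (Sum.inr (Sum.inl c.2.2.1)),
      fun c => Sum.inr (Sum.inr (Sum.inr c.2.2.2)), a, a, a]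
  have main := jointEntropy_four_variable_inequality (p := fun c => μ.real (Z ⁻¹' {c}))
    (fun _ => measureReal_nonneg) Y
  rw [jointEntropy_eq_shannonEntropy μ Z hZ Y (fun c => c.1) {0} (by simp [Y, a]),
    jointEntropy_eq_shannonEntropy μ Z hZ Y (fun c => c.2.1) {1} (by simp [Y]),
    jointEntropy_eq_shannonEntropy μ Z hZ Y (fun c => c.2.2.1) {2} (by simp [Y]),
    jointEntropy_eq_shannonEntropy μ Z hZ Y (fun c => c.2.2.2) {3} (by simp [Y]),
    jointEntropy_eq_shannonEntropy μ Z hZ Y (fun c => (c.1, c.2.1)) {0, 1} (by simp [Y, a]),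
    jointEntropy_eq_shannonEntropy μ Z hZ Y (fun c => (c.1, c.2.2.1)) {0, 2} (by simp [Y, a]),
    jointEntropy_eq_shannonEntropy μ Z hZ Y (fun c => (c.2.1, c.2.2.1)) {1, 2} (by simp [Y]),
    jointEntropy_eq_shannonEntropy μ Z hZ Y (fun c => (c.1, c.2.2.2)) {0, 3} (by simp [Y, a]),
    jointEntropy_eq_shannonEntropy μ Z hZ Y (fun c => (c.2.1, c.2.2.2)) {1, 3} (by simp [Y]),
    jointEntropy_eq_shannonEntropy μ Z hZ Y (fun c => (c.2.2.1, c.2.2.2)) {2, 3} (by simp [Y]),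
    jointEntropy_eq_shannonEntropy μ Z hZ Y (fun c => (c.1, c.2.1, c.2.2.1)) {0, 1, 2}
      (by simp [Y, a]),
    jointEntropy_eq_shannonEntropy μ Z hZ Y (fun c => (c.1, c.2.2.1, c.2.2.2)) {0, 2, 3}
      (by simp [Y, a])] at main
  exact main
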